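/- Let γ ≥ 2/3 and H = H₀ − (γT₁ + T₂) on L²([0,1]², Lebesgue). Then E_min(H) = −γ, and H exhibits the Efimov effect below the bottom of its essential spectrum: H has infinitely many eigenvalues (counted with multiplicity) strictly below −γ, and these eigenvalues accumulate at −γ. -/

import Mathlib

open MeasureTheory Filter Topology Metric

noncomputable section

namespace EfimovExample

/-- `pₙ = 1 - 2⁻ⁿ` (so `p₀ = 0`, `p₁ = 1/2`, ...). -/
def p (n : ℕ) : ℝ := 1 - (1 / 2 : ℝ) ^ n

/-- `qₙ = (p_{n-1} + pₙ)/2`, the midpoint of `[p_{n-1}, pₙ]`. -/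
def q (n : ℕ) : ℝ := (p (n - 1) + p n) / 2

/-- `ξₙ(y) = π (y - p_{n-1})/(pₙ - p_{n-1})` on `[p_{n-1}, pₙ]` and `0` elsewhere. -/
def ξ (n : ℕ) (y : ℝ) : ℝ :=
  if y ∈ Set.Icc (p (n - 1)) (p n) then
    Real.pi * (y - p (n - 1)) / (p n - p (n - 1))
  else 0

/-- `φₙ(y) = 2^{(n+1)/2} sin (ξₙ(y))`. -/
def φ (n : ℕ) (y : ℝ) : ℝ := 2 ^ ((n + 1 : ℝ) / 2) * Real.sin (ξ n y)

/-- The kernel `k₂(y,t) = Σ_{n ≥ 1} (2/3)ⁿ φₙ(y) φₙ(t)`. -/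
def k₂ (y t : ℝ) : ℝ := ∑' n : ℕ, (2 / 3 : ℝ) ^ (n + 1) * φ (n + 1) y * φ (n + 1) t

/-- The tent function `rₙ`, supported on `[p_{n-1}, pₙ]` with peak `1` at `qₙ`. -/
def r (n : ℕ) (x : ℝ) : ℝ :=
  if x ∈ Set.Icc (p (n - 1)) (q n) then (x - p (n - 1)) / (q n - p (n - 1))
  else if x ∈ Set.Icc (q n) (p n) then (p n - x) / (p n - q n)
  else 0

/-- `u(x) = 0` on `[0, 1/2]`, and `u(x) = Σ_{n ≥ 1} δₙ rₙ(x)` for `x > 1/2`. -/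
def u (δ : ℕ → ℝ) (x : ℝ) : ℝ :=
  if x ≤ 1 / 2 then 0 else ∑' n : ℕ, δ (n + 1) * r (n + 1) x

/-- Lebesgue measure on `[0,1]`. -/
def μI : Measure ℝ := volume.restrict (Set.Icc 0 1)

/-- Lebesgue measure on `[0,1]²`. -/
def μI2 : Measure (ℝ × ℝ) := μI.prod μI

variable {𝓗 : Type*} [NormedAddCommGroup 𝓗] [InnerProductSpace ℂ 𝓗]

/-- `z` is an isolated point of the set `S`. -/
def IsIsolatedIn (S : Set ℂ) (z : ℂ) : Prop :=
  z ∈ S ∧ ∃ ε > 0, S ∩ Metric.ball z ε = {z}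

/-- Discrete spectrum: the set of isolated points of the spectrum that are eigenvalues of
finite multiplicity. -/
def discreteSpectrum (A : 𝓗 →L[ℂ] 𝓗) : Set ℂ :=
  {z | IsIsolatedIn (spectrum ℂ A) z ∧
    Module.End.HasEigenvalue (A : 𝓗 →ₗ[ℂ] 𝓗) z ∧
    FiniteDimensional ℂ (Module.End.eigenspace (A : 𝓗 →ₗ[ℂ] 𝓗) z)}

/-- Essential spectrum: spectrum minus discrete spectrum. -/
def essSpectrum (A : 𝓗 →L[ℂ] 𝓗) : Set ℂ :=
  spectrum ℂ A \ discreteSpectrum A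

/-- Bottom of the essential spectrum (as a real number). -/
def Emin (A : 𝓗 →L[ℂ] 𝓗) : ℝ :=
  sInf {x : ℝ | (x : ℂ) ∈ essSpectrum A}

/-- The span of all eigenspaces with (real) eigenvalue strictly below `E`. -/
def eigBelow (A : 𝓗 →L[ℂ] 𝓗) (E : ℝ) : Submodule ℂ 𝓗 :=
  ⨆ t : {t : ℝ // t < E}, Module.End.eigenspace (A : 𝓗 →ₗ[ℂ] 𝓗) ((t : ℝ) : ℂ)

section Abstract

variable [CompleteSpace 𝓗]

lemma form_lower (A : 𝓗 →L[ℂ] 𝓗) {E l : ℝ}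
    (hpos : ∀ f : 𝓗, E * ‖f‖ ^ 2 ≤ (inner ℂ f (A f)).re) (f : 𝓗) :
    (E - l) * ‖f‖ ≤ ‖A f - (l : ℂ) • f‖ := by
  by_cases hf : f = 0
  · simp [hf]
  have hn : 0 < ‖f‖ := norm_pos_iff.mpr hf
  have h1 : (inner ℂ f (A f - (l : ℂ) • f)).re = (inner ℂ f (A f)).re - l * ‖f‖ ^ 2 := by
    rw [inner_sub_right, inner_smul_right, inner_self_eq_norm_sq_to_K, Complex.sub_re,
      Complex.re_ofReal_mul]
    norm_cast
  have h2 : (inner ℂ f (A f - (l : ℂ) • f)).re ≤ ‖f‖ * ‖A f - (l : ℂ) • f‖ :=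
    (Complex.re_le_norm _).trans (norm_inner_le_norm _ _)
  have h3 := hpos f
  have : ‖f‖ * ((E - l) * ‖f‖) ≤ ‖f‖ * ‖A f - (l : ℂ) • f‖ := by nlinarith
  exact le_of_mul_le_mul_left this hn

/-- Weyl-type compactness lemma. -/
lemma key_compact (H C : 𝓗 →L[ℂ] 𝓗) (hC : IsCompactOperator C) {E l R : ℝ} (hl : l < E)
    (hpos : ∀ f : 𝓗, E * ‖f‖ ^ 2 ≤ (inner ℂ f (H f + C f)).re)
    (lam : ℕ → ℝ) (hlam : Tendsto lam atTop (𝓝 l)) (f : ℕ → 𝓗) (hf : ∀ n, ‖f n‖ ≤ R)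
    (hz : Tendsto (fun n => H (f n) - (lam n : ℂ) • f n) atTop (𝓝 0)) :
    ∃ v : 𝓗, ∃ ψ : ℕ → ℕ, StrictMono ψ ∧ Tendsto (f ∘ ψ) atTop (𝓝 v) ∧ H v = (l : ℂ) • v := by
  obtain ⟨K, hK, hKs⟩ := hC.image_closedBall_subset_compact (𝕜₁ := ℂ) (f := (C : 𝓗 →ₗ[ℂ] 𝓗)) R
  obtain ⟨w, -, ψ, hψ, hw⟩ := hK.tendsto_subseq (x := fun n => C (f n))
    (fun n => hKs ⟨f n, by simpa using hf n, rfl⟩)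
  have hz' := hz.comp hψ.tendsto_atTop
  have hlam' := hlam.comp hψ.tendsto_atTop
  have h0 : Tendsto (fun n => ((lam (ψ n) - l : ℝ) : ℂ) • f (ψ n)) atTop (𝓝 0) := by
    apply squeeze_zero_norm (a := fun n => |lam (ψ n) - l| * R)
    · intro n
      rw [norm_smul, Complex.norm_real]
      exact mul_le_mul_of_nonneg_left (hf _) (abs_nonneg _)
    · have : Tendsto (fun n => |lam (ψ n) - l| * R) atTop (𝓝 (|l - l| * R)) :=
        ((hlam'.sub_const l).abs).mul_const R
      simpa using this
  let L : 𝓗 →L[ℂ] 𝓗 := H + C - (l : ℂ) • ContinuousLinearMap.id ℂ 𝓗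
  have hL : ∀ f, L f = (H + C) f - (l : ℂ) • f := fun f => by simp [L]
  have hconv : Tendsto (fun n => L (f (ψ n))) atTop (𝓝 w) := by
    have := (hz'.add hw).add h0
    simp only [zero_add, add_zero] at this
    refine this.congr fun n => ?_
    simp only [L, Function.comp, sub_apply, add_apply,
      smul_apply, ContinuousLinearMap.id_apply, Complex.ofReal_sub, sub_smul]
    abel
  have hlow : ∀ x, (E - l) * ‖x‖ ≤ ‖L x‖ := fun x => by
    rw [hL]; exact form_lower (H + C) (by simpa using hpos) x
  have hcau : CauchySeq (fun n => f (ψ n)) := by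
    have h1 := hconv.cauchySeq
    rw [Metric.cauchySeq_iff] at h1 ⊢
    intro ε hε
    obtain ⟨N, hN⟩ := h1 ((E - l) * ε) (mul_pos (by linarith) hε)
    refine ⟨N, fun m hm n hn => ?_⟩
    have h2 := hN m hm n hn
    rw [dist_eq_norm, ← map_sub] at h2
    rw [dist_eq_norm]
    have h3 := hlow (f (ψ m) - f (ψ n))
    exact lt_of_mul_lt_mul_left (h3.trans_lt h2) (by linarith)
  obtain ⟨v, hv⟩ := cauchySeq_tendsto_of_complete hcau
  refine ⟨v, ψ, hψ, hv, ?_⟩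
  have h1 : Tendsto (fun n => H (f (ψ n)) - (lam (ψ n) : ℂ) • f (ψ n)) atTop
      (𝓝 (H v - (l : ℂ) • v)) :=
    ((H.continuous.tendsto v).comp hv).sub
      (((Complex.continuous_ofReal.tendsto l).comp hlam').smul hv)
  exact sub_eq_zero.mp (tendsto_nhds_unique h1 hz')

lemma isUnit_of_bdd (H : 𝓗 →L[ℂ] 𝓗) (hH : ∀ f g, inner ℂ (H f) g = inner ℂ f (H g)) (l : ℝ)
    (c : ℝ) (hc : 0 < c) (h : ∀ f, c * ‖f‖ ≤ ‖H f - (l : ℂ) • f‖) :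
    (l : ℂ) ∉ spectrum ℂ H := by
  intro hs
  rw [spectrum.mem_iff, ← IsUnit.neg_iff] at hs
  apply hs
  have e : ∀ f, (-(algebraMap ℂ (𝓗 →L[ℂ] 𝓗) (l : ℂ) - H)) f = H f - (l : ℂ) • f := fun f => by
    simp [Algebra.algebraMap_eq_smul_one]
  rw [ContinuousLinearMap.isUnit_iff_bijective,
    ContinuousLinearMap.bijective_iff_dense_range_and_antilipschitz]
  constructor
  · rw [Submodule.topologicalClosure_eq_top_iff, Submodule.eq_bot_iff]
    intro x hx
    have h1 : ∀ f, inner ℂ (H f - (l : ℂ) • f) x = 0 := fun f => by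
      have := hx _ ⟨f, rfl⟩
      rw [← this]
      congr 1
      exact (e f).symm
    have h2 : H x - (l : ℂ) • x = 0 := by
      have h4 : ∀ y, inner ℂ y (H x - (l : ℂ) • x) = inner ℂ (H y - (l : ℂ) • y) x := fun y => by
        rw [inner_sub_right, inner_sub_left, inner_smul_left, inner_smul_right, hH,
          Complex.conj_ofReal]
      rw [← inner_self_eq_zero (𝕜 := ℂ), h4, h1]
    have h3 := h x
    rw [h2, norm_zero] at h3
    have : ‖x‖ ≤ 0 := by nlinarith [norm_nonneg x]
    simpa using this
  · refine ⟨⟨c⁻¹, by positivity⟩, ContinuousLinearMap.antilipschitz_of_bound _ fun x => ?_⟩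
    rw [e]
    have := h x
    change ‖x‖ ≤ c⁻¹ * _
    rw [← div_eq_inv_mul, le_div_iff₀ hc]
    linarith

lemma eig_of_spec (H C : 𝓗 →L[ℂ] 𝓗) (hH : ∀ f g, inner ℂ (H f) g = inner ℂ f (H g))
    (hC : IsCompactOperator C) {E l : ℝ} (hl : l < E)
    (hpos : ∀ f : 𝓗, E * ‖f‖ ^ 2 ≤ (inner ℂ f (H f + C f)).re)
    (hs : (l : ℂ) ∈ spectrum ℂ H) : ∃ v : 𝓗, ‖v‖ = 1 ∧ H v = (l : ℂ) • v := by
  have h1 : ∀ n : ℕ, ∃ f : 𝓗, ‖f‖ = 1 ∧ ‖H f - (l : ℂ) • f‖ ≤ 1 / ((n : ℝ) + 1) := by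
    intro n
    by_contra hcon
    push Not at hcon
    refine isUnit_of_bdd H hH l (1 / ((n : ℝ) + 1)) (by positivity) (fun f => ?_) hs
    by_cases hf : f = 0
    · simp [hf]
    have hn : 0 < ‖f‖ := norm_pos_iff.mpr hf
    have h2 := hcon (((‖f‖⁻¹ : ℝ) : ℂ) • f) (by
      rw [norm_smul, Complex.norm_real, norm_inv, norm_norm, inv_mul_cancel₀ hn.ne'])
    rw [map_smul, smul_comm, ← smul_sub, norm_smul, Complex.norm_real, norm_inv, norm_norm,
      ← div_eq_inv_mul, lt_div_iff₀ hn] at h2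
    exact h2.le
  choose f hf1 hf2 using h1
  obtain ⟨v, ψ, hψ, hv, hev⟩ := key_compact H C hC hl hpos (fun _ => l) tendsto_const_nhds f
    (fun n => (hf1 n).le) (squeeze_zero_norm hf2 tendsto_one_div_add_atTop_nhds_zero_nat)
  refine ⟨v, ?_, hev⟩
  have := hv.norm
  simp only [Function.comp, hf1] at this
  exact (tendsto_nhds_unique this tendsto_const_nhds)

lemma hasEig_of (H : 𝓗 →L[ℂ] 𝓗) {l : ℝ} {v : 𝓗} (hv : ‖v‖ = 1) (h : H v = (l : ℂ) • v) :
    Module.End.HasEigenvalue (H : 𝓗 →ₗ[ℂ] 𝓗) (l : ℂ) := by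
  apply Module.End.hasEigenvalue_of_hasEigenvector (x := v)
  refine ⟨Module.End.mem_eigenspace_iff.mpr h, ?_⟩
  rintro rfl
  simp at hv

lemma spec_of_eig (H : 𝓗 →L[ℂ] 𝓗) {z : ℂ} {v : 𝓗} (hv : v ≠ 0) (h : H v = z • v) :
    z ∈ spectrum ℂ H := by
  rw [spectrum.mem_iff]
  intro hu
  rw [ContinuousLinearMap.isUnit_iff_bijective] at hu
  apply hv
  apply hu.1
  simp [Algebra.algebraMap_eq_smul_one, h]

lemma eig_orth (H : 𝓗 →L[ℂ] 𝓗) (hH : ∀ f g, inner ℂ (H f) g = inner ℂ f (H g)) {a b : ℝ}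
    (hab : a ≠ b) {v w : 𝓗} (hv : H v = (a : ℂ) • v) (hw : H w = (b : ℂ) • w) :
    inner ℂ v w = 0 := by
  have := hH v w
  rw [hv, hw, inner_smul_left, inner_smul_right, Complex.conj_ofReal] at this
  have h2 : ((a : ℂ) - b) * inner ℂ v w = 0 := by rw [sub_mul, this, sub_self]
  rcases mul_eq_zero.mp h2 with h | h
  · exact absurd (by exact_mod_cast sub_eq_zero.mp h) hab
  · exact h

lemma disc_of_spec (H C : 𝓗 →L[ℂ] 𝓗) (hH : ∀ f g, inner ℂ (H f) g = inner ℂ f (H g))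
    (hC : IsCompactOperator C) {E l : ℝ} (hl : l < E)
    (hpos : ∀ f : 𝓗, E * ‖f‖ ^ 2 ≤ (inner ℂ f (H f + C f)).re)
    (hs : (l : ℂ) ∈ spectrum ℂ H) : (l : ℂ) ∈ discreteSpectrum H := by
  have hsa : IsSelfAdjoint H :=
    (ContinuousLinearMap.isSelfAdjoint_iff_isSymmetric).mpr hH
  refine ⟨⟨hs, ?_⟩, ?_, ?_⟩
  · by_contra hcon
    push Not at hcon
    have h1 : ∀ n : ℕ, ∃ a : ℝ, a ≠ l ∧ (a : ℂ) ∈ spectrum ℂ H ∧ |a - l| < 1 / ((n : ℝ) + 1) := by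
      intro n
      by_contra hno
      push Not at hno
      apply hcon (1 / ((n : ℝ) + 1)) (by positivity)
      ext z
      constructor
      · rintro ⟨hz1, hz2⟩
        have hre := hsa.mem_spectrum_eq_re hz1
        by_contra hne
        have h3 := hno z.re (fun h => hne (by rw [hre, h]; rfl)) (hre ▸ hz1)
        rw [Metric.mem_ball, hre, dist_eq_norm, ← Complex.ofReal_sub, Complex.norm_real,
          Real.norm_eq_abs] at hz2
        linarith
      · rintro rfl
        exact ⟨hs, Metric.mem_ball_self (by positivity)⟩
    choose a ha1 ha2 ha3 using h1
    have hat : Tendsto a atTop (𝓝 l) := by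
      rw [tendsto_iff_norm_sub_tendsto_zero]
      exact squeeze_zero (fun _ => norm_nonneg _) (fun n => (ha3 n).le)
        tendsto_one_div_add_atTop_nhds_zero_nat
    obtain ⟨N, hN⟩ := eventually_atTop.mp (hat.eventually (gt_mem_nhds hl))
    have h2 : ∀ n, ∃ v : 𝓗, ‖v‖ = 1 ∧ H v = (a (n + N) : ℂ) • v := fun n =>
      eig_of_spec H C hH hC (hN (n + N) (by omega)) hpos (ha2 _)
    choose f hf1 hf2 using h2
    obtain ⟨v, ψ, hψ, hv, hev⟩ := key_compact H C hC hl hpos (fun n => a (n + N))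
      (hat.comp (tendsto_add_atTop_nat N)) f (fun n => (hf1 n).le) (by simp [hf2])
    have hv1 := hv.norm
    simp only [Function.comp, hf1] at hv1
    have hv1 := tendsto_nhds_unique hv1 tendsto_const_nhds
    have h3 : Tendsto (fun n => inner ℂ (f (ψ n)) v) atTop (𝓝 (inner ℂ v v)) :=
      hv.inner tendsto_const_nhds
    have h4 : ∀ n, inner ℂ (f (ψ n)) v = 0 := fun n => eig_orth H hH (ha1 _) (hf2 _) hev
    simp only [h4] at h3
    have h5 := tendsto_nhds_unique h3 tendsto_const_nhds
    rw [inner_self_eq_zero] at h5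
    simp [h5] at hv1
  · obtain ⟨v, hv, h⟩ := eig_of_spec H C hH hC hl hpos hs
    exact hasEig_of H hv h
  · by_contra hcon
    obtain ⟨R, f, -, hf1, hf2⟩ := exists_seq_norm_le_one_le_norm_sub hcon
    have hm : ∀ n, H (f n : 𝓗) = (l : ℂ) • (f n : 𝓗) := fun n =>
      Module.End.mem_eigenspace_iff.mp (f n).2
    obtain ⟨v, ψ, hψ, hv, hev⟩ := key_compact H C hC hl hpos (fun n => l)
      tendsto_const_nhds (fun n => (f n : 𝓗)) hf1 (by simp [hm])
    have h1 := hv.cauchySeq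
    rw [Metric.cauchySeq_iff] at h1
    obtain ⟨N, hN⟩ := h1 1 one_pos
    have h2 := hN (N + 1) (by omega) N (by omega)
    rw [dist_eq_norm] at h2
    exact absurd h2 (not_lt.mpr (hf2 (fun h => by have := hψ.injective h; omega)))

lemma exists_eig_near (H C : 𝓗 →L[ℂ] 𝓗) (hH : ∀ f g, inner ℂ (H f) g = inner ℂ f (H g))
    (hC : IsCompactOperator C) {E : ℝ}
    (hpos : ∀ f : 𝓗, E * ‖f‖ ^ 2 ≤ (inner ℂ f (H f + C f)).re)
    (hneg : ∀ N : ℕ, ∃ F : (Fin N → ℂ) →ₗ[ℂ] 𝓗, ∀ a, a ≠ 0 →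
      (inner ℂ (F a) (H (F a))).re < E * ‖F a‖ ^ 2)
    (ε : ℝ) (hε : 0 < ε) :
    ∃ m : ℝ, E - ε < m ∧ m < E ∧ Module.End.HasEigenvalue (H : 𝓗 →ₗ[ℂ] 𝓗) (m : ℂ) := by
  have hspec_eig : ∀ t : ℝ, Module.End.HasEigenvalue (H : 𝓗 →ₗ[ℂ] 𝓗) (t : ℂ) →
      (t : ℂ) ∈ spectrum ℂ H := by
    intro t ht
    obtain ⟨v, hv⟩ := ht.exists_hasEigenvector
    exact spec_of_eig H hv.2 (Module.End.mem_eigenspace_iff.mp hv.1)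
  set S : Set ℝ := {t | t ≤ E - ε ∧ Module.End.HasEigenvalue (H : 𝓗 →ₗ[ℂ] 𝓗) (t : ℂ)} with hS
  have hfin : S.Finite := by
    by_contra hinf
    have hinf : S.Infinite := hinf
    have hsub : S ⊆ Set.Icc (-(‖H‖ * ‖(1 : 𝓗 →L[ℂ] 𝓗)‖)) (E - ε) := by
      intro t ht
      have h1 := spectrum.norm_le_norm_mul_of_mem (hspec_eig t ht.2)
      rw [Complex.norm_real] at h1
      exact ⟨neg_le_of_abs_le h1, ht.1⟩
    obtain ⟨l, hlK, hl⟩ := hinf.exists_accPt_of_subset_isCompact isCompact_Icc hsub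
    have hlE : l < E := by linarith [hlK.2]
    rw [accPt_iff_frequently] at hl
    have hcl : IsClosed {t : ℝ | (t : ℂ) ∈ spectrum ℂ H} :=
      (spectrum.isClosed H).preimage Complex.continuous_ofReal
    have hls : (l : ℂ) ∈ spectrum ℂ H := by
      have : l ∈ closure {t : ℝ | (t : ℂ) ∈ spectrum ℂ H} := by
        rw [mem_closure_iff_frequently]
        exact hl.mono fun t ht => hspec_eig t ht.2.2
      rwa [hcl.closure_eq] at this
    obtain ⟨⟨-, e, he, heq⟩, -⟩ := disc_of_spec H C hH hC hlE hpos hls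
    obtain ⟨t, ht1, ht2⟩ := (hl.and_eventually (Metric.ball_mem_nhds l he)).exists
    have : (t : ℂ) ∈ spectrum ℂ H ∩ Metric.ball (l : ℂ) e := by
      refine ⟨hspec_eig t ht1.2.2, ?_⟩
      rw [Metric.mem_ball, Complex.dist_eq, ← Complex.ofReal_sub, Complex.norm_real]
      exact ht2
    rw [heq] at this
    exact ht1.1 (Complex.ofReal_injective this)
  let V : Submodule ℂ 𝓗 := ⨆ t : S, Module.End.eigenspace (H : 𝓗 →ₗ[ℂ] 𝓗) ((t : ℝ) : ℂ)
  have : Finite S := hfin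
  have hVi : ∀ t : S, FiniteDimensional ℂ (Module.End.eigenspace (H : 𝓗 →ₗ[ℂ] 𝓗) ((t : ℝ) : ℂ)) :=
    fun t => (disc_of_spec H C hH hC (by linarith [t.2.1]) hpos (hspec_eig t t.2.2)).2.2
  have hV : FiniteDimensional ℂ V := Submodule.finiteDimensional_iSup _
  have hmV : ∀ f, f ∈ Vᗮ ↔ ∀ t : S, ∀ v, H v = ((t : ℝ) : ℂ) • v → inner ℂ v f = 0 := by
    intro f
    simp only [V, ← Submodule.iInf_orthogonal, Submodule.mem_iInf, Submodule.mem_orthogonal,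
      Module.End.mem_eigenspace_iff]
    rfl
  have hinv : ∀ f ∈ Vᗮ, H f ∈ Vᗮ := by
    intro f hf
    rw [hmV] at hf ⊢
    intro t v hv
    rw [← hH, hv, inner_smul_left, hf t v hv, mul_zero]
  obtain ⟨g, hgV, hg⟩ : ∃ g ∈ Vᗮ, (inner ℂ g (H g)).re < E * ‖g‖ ^ 2 := by
    obtain ⟨F, hF⟩ := hneg (Module.finrank ℂ V + 1)
    let P : (Fin (Module.finrank ℂ V + 1) → ℂ) →ₗ[ℂ] V :=
      (V.orthogonalProjectionOnto : 𝓗 →ₗ[ℂ] V) ∘ₗ F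
    have hker : LinearMap.ker P ≠ ⊥ := LinearMap.ker_ne_bot_of_finrank_lt (by simp)
    obtain ⟨a, ha, ha0⟩ := (Submodule.ne_bot_iff _).mp hker
    refine ⟨F a, ?_, hF a ha0⟩
    rw [← Submodule.orthogonalProjectionOnto_eq_zero_iff]
    exact ha
  have hg0 : 0 < ‖g‖ := by
    rw [norm_pos_iff]; rintro rfl; simp at hg
  let Q : Set ℝ := (fun f => (inner ℂ f (H f)).re) '' {f | f ∈ Vᗮ ∧ ‖f‖ = 1}
  have hQb : BddBelow Q := by
    refine ⟨-‖H‖, ?_⟩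
    rintro _ ⟨f, ⟨-, hf⟩, rfl⟩
    have h1 := (Complex.abs_re_le_norm (inner ℂ f (H f))).trans (norm_inner_le_norm f (H f))
    have h2 := H.le_opNorm f
    rw [hf] at h1 h2
    have := neg_abs_le (inner ℂ f (H f)).re
    simp only
    linarith
  have hg1 : (inner ℂ g (H g)).re / ‖g‖ ^ 2 ∈ Q := by
    refine ⟨((‖g‖⁻¹ : ℝ) : ℂ) • g, ⟨Vᗮ.smul_mem _ hgV, ?_⟩, ?_⟩
    · rw [norm_smul, Complex.norm_real, norm_inv, norm_norm, inv_mul_cancel₀ hg0.ne']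
    · simp only [map_smul, inner_smul_left, inner_smul_right, Complex.conj_ofReal,
        Complex.re_ofReal_mul]
      field_simp
  set m := sInf Q with hm
  have hmE : m < E := by
    refine (csInf_le hQb hg1).trans_lt ?_
    rw [div_lt_iff₀ (by positivity)]
    exact hg
  have hml : ∀ f ∈ Vᗮ, m * ‖f‖ ^ 2 ≤ (inner ℂ f (H f)).re := by
    intro f hf
    by_cases hf0 : f = 0
    · simp [hf0]
    have hn : 0 < ‖f‖ := norm_pos_iff.mpr hf0
    have : m ≤ (inner ℂ f (H f)).re / ‖f‖ ^ 2 := by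
      refine csInf_le hQb ⟨((‖f‖⁻¹ : ℝ) : ℂ) • f, ⟨Vᗮ.smul_mem _ hf, ?_⟩, ?_⟩
      · rw [norm_smul, Complex.norm_real, norm_inv, norm_norm, inv_mul_cancel₀ hn.ne']
      · simp only [map_smul, inner_smul_left, inner_smul_right, Complex.conj_ofReal,
          Complex.re_ofReal_mul]
        field_simp
    rwa [le_div_iff₀ (by positivity)] at this
  let T : 𝓗 →L[ℂ] 𝓗 := H - (m : ℂ) • ContinuousLinearMap.id ℂ 𝓗
  have hT : ∀ f, T f = H f - (m : ℂ) • f := fun f => by simp [T]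
  have hTs : ∀ f g, inner ℂ (T f) g = inner ℂ f (T g) := fun f g => by
    simp [hT, inner_sub_left, inner_sub_right, hH, inner_smul_left, inner_smul_right]
  have hTf : ∀ f, (inner ℂ f (T f)).re = (inner ℂ f (H f)).re - m * ‖f‖ ^ 2 := fun f => by
    rw [hT, inner_sub_right, inner_smul_right, inner_self_eq_norm_sq_to_K, Complex.sub_re,
      Complex.re_ofReal_mul]
    norm_cast
  have hTV : ∀ f ∈ Vᗮ, T f ∈ Vᗮ := fun f hf => by
    rw [hT]; exact Vᗮ.sub_mem (hinv f hf) (Vᗮ.smul_mem _ hf)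
  have hTbound : ∀ f ∈ Vᗮ, ‖T f‖ ^ 2 ≤ (‖T‖ + 1) * (inner ℂ f (T f)).re := by
    intro f hf
    set M := ‖T‖ + 1 with hM
    have hM0 : 0 < M := by positivity
    set g := T f with hgdef
    have hgm : g ∈ Vᗮ := hTV f hf
    have h1 := hml (f - ((M⁻¹ : ℝ) : ℂ) • g) (Vᗮ.sub_mem hf (Vᗮ.smul_mem _ hgm))
    have h2 := hTf (f - ((M⁻¹ : ℝ) : ℂ) • g)
    have h3 : (inner ℂ (f - ((M⁻¹ : ℝ) : ℂ) • g) (T (f - ((M⁻¹ : ℝ) : ℂ) • g))).re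
        = (inner ℂ f g).re - 2 * M⁻¹ * ‖g‖ ^ 2 + M⁻¹ * (M⁻¹ * (inner ℂ g (T g)).re) := by
      rw [map_sub, map_smul, ← hgdef]
      simp only [inner_sub_left, inner_sub_right, inner_smul_left, inner_smul_right,
        Complex.conj_ofReal, Complex.sub_re, Complex.re_ofReal_mul]
      rw [← hTs f g, ← hgdef]
      have : (inner ℂ g g).re = ‖g‖ ^ 2 := by
        rw [inner_self_eq_norm_sq_to_K]; norm_cast
      rw [this]; ring
    have h4 : (inner ℂ g (T g)).re ≤ M * ‖g‖ ^ 2 := by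
      have := (Complex.re_le_norm (inner ℂ g (T g))).trans (norm_inner_le_norm g (T g))
      have h5 := T.le_opNorm g
      nlinarith [norm_nonneg g, norm_nonneg T]
    have h5 : M⁻¹ * (inner ℂ g (T g)).re ≤ ‖g‖ ^ 2 := by
      rw [← div_eq_inv_mul, div_le_iff₀ hM0]; linarith
    have h6 : M⁻¹ * ‖g‖ ^ 2 ≤ (inner ℂ f g).re := by
      have hMi : 0 < M⁻¹ := by positivity
      nlinarith
    rw [← div_eq_inv_mul, div_le_iff₀ hM0] at h6
    linarith
  have hseq : ∀ n : ℕ, ∃ f ∈ Vᗮ, ‖f‖ = 1 ∧ (inner ℂ f (T f)).re < 1 / ((n : ℝ) + 1) := by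
    intro n
    obtain ⟨_, ⟨f, ⟨hfV, hf1⟩, rfl⟩, hlt⟩ := exists_lt_of_csInf_lt ⟨_, hg1⟩
      (lt_add_of_pos_right m (show (0 : ℝ) < 1 / ((n : ℝ) + 1) by positivity))
    refine ⟨f, hfV, hf1, ?_⟩
    rw [hTf, hf1]
    simp only at hlt
    linarith
  choose f hfV hf1 hf2 using hseq
  have hT0 : Tendsto (fun n => H (f n) - (m : ℂ) • f n) atTop (𝓝 0) := by
    have h1 : Tendsto (fun n : ℕ => Real.sqrt ((‖T‖ + 1) * (1 / ((n : ℝ) + 1)))) atTop (𝓝 0) := by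
      have := ((tendsto_one_div_add_atTop_nhds_zero_nat (𝕜 := ℝ)).const_mul (‖T‖ + 1)).sqrt
      simpa using this
    refine squeeze_zero_norm (fun n => ?_) h1
    rw [← hT]
    apply Real.le_sqrt_of_sq_le
    exact (hTbound _ (hfV n)).trans (mul_le_mul_of_nonneg_left (hf2 n).le (by positivity))
  obtain ⟨v, ψ, hψ, hv, hev⟩ := key_compact H C hC hmE hpos (fun n => m)
    tendsto_const_nhds f (fun n => (hf1 n).le) hT0
  have hv1 := hv.norm
  simp only [Function.comp, hf1] at hv1
  have hv1 := tendsto_nhds_unique hv1 tendsto_const_nhds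
  have hvV : v ∈ Vᗮ := V.isClosed_orthogonal.mem_of_tendsto hv
    (Eventually.of_forall fun n => hfV _)
  refine ⟨m, ?_, hmE, hasEig_of H hv1 hev⟩
  by_contra hle
  push Not at hle
  have := (hmV v).mp hvV ⟨m, hle, hasEig_of H hv1 hev⟩ v hev
  rw [inner_self_eq_zero] at this
  simp [this] at hv1

/-- Abstract conclusion. -/
theorem abstract_efimov (H C : 𝓗 →L[ℂ] 𝓗) (hH : ∀ f g, inner ℂ (H f) g = inner ℂ f (H g))
    (hC : IsCompactOperator C) {E : ℝ}
    (hpos : ∀ f : 𝓗, E * ‖f‖ ^ 2 ≤ (inner ℂ f (H f + C f)).re)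
    (hneg : ∀ N : ℕ, ∃ F : (Fin N → ℂ) →ₗ[ℂ] 𝓗, ∀ a, a ≠ 0 →
      (inner ℂ (F a) (H (F a))).re < E * ‖F a‖ ^ 2) :
    Emin H = E ∧ ¬ FiniteDimensional ℂ (eigBelow H E) ∧
    ∃ ω : ℕ → ℝ, (∀ n, ω n < E ∧ Module.End.HasEigenvalue (H : 𝓗 →ₗ[ℂ] 𝓗) ((ω n : ℝ) : ℂ)) ∧
      Tendsto ω atTop (nhds E) := by
  have hspec_eig : ∀ t : ℝ, Module.End.HasEigenvalue (H : 𝓗 →ₗ[ℂ] 𝓗) (t : ℂ) →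
      (t : ℂ) ∈ spectrum ℂ H := by
    intro t ht
    obtain ⟨v, hv⟩ := ht.exists_hasEigenvector
    exact spec_of_eig H hv.2 (Module.End.mem_eigenspace_iff.mp hv.1)
  have hex := exists_eig_near H C hH hC hpos hneg
  have h1 : ∀ n : ℕ, ∃ m : ℝ, E - 1 / ((n : ℝ) + 1) < m ∧ m < E ∧
      Module.End.HasEigenvalue (H : 𝓗 →ₗ[ℂ] 𝓗) (m : ℂ) := fun n => hex _ (by positivity)
  choose ω hω1 hω2 hω3 using h1
  have hωt : Tendsto ω atTop (𝓝 E) := by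
    refine tendsto_of_tendsto_of_tendsto_of_le_of_le (g := fun n : ℕ => E - 1 / ((n : ℝ) + 1))
      (h := fun _ => E) ?_ tendsto_const_nhds (fun n => (hω1 n).le) (fun n => (hω2 n).le)
    simpa using (tendsto_one_div_add_atTop_nhds_zero_nat (𝕜 := ℝ)).const_sub E
  refine ⟨?_, ?_, ω, fun n => ⟨hω2 n, hω3 n⟩, hωt⟩
  · have hmem : (E : ℂ) ∈ essSpectrum H := by
      have hωc : Tendsto (fun n => (ω n : ℂ)) atTop (𝓝 (E : ℂ)) :=
        (Complex.continuous_ofReal.tendsto E).comp hωt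
      refine ⟨(spectrum.isClosed H).mem_of_tendsto hωc
        (Eventually.of_forall fun n => hspec_eig _ (hω3 n)), ?_⟩
      rintro ⟨⟨-, e, he, heq⟩, -⟩
      obtain ⟨n, hn⟩ := (hωc.eventually (Metric.ball_mem_nhds _ he)).exists
      have : (ω n : ℂ) ∈ spectrum ℂ H ∩ Metric.ball (E : ℂ) e := ⟨hspec_eig _ (hω3 n), hn⟩
      rw [heq] at this
      have h3 : ω n = E := Complex.ofReal_injective this
      linarith [hω2 n]
    have hlb : ∀ x ∈ {x : ℝ | (x : ℂ) ∈ essSpectrum H}, E ≤ x := by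
      rintro x ⟨hx1, hx2⟩
      by_contra hlt
      exact hx2 (disc_of_spec H C hH hC (not_le.mp hlt) hpos hx1)
    exact le_antisymm (csInf_le ⟨E, hlb⟩ hmem) (le_csInf ⟨E, hmem⟩ hlb)
  · intro hfd
    have hinf : (Set.range ω).Infinite := by
      intro hf
      have : E ∈ Set.range ω := hf.isClosed.mem_of_tendsto hωt
        (Eventually.of_forall fun n => Set.mem_range_self n)
      obtain ⟨n, hn⟩ := this
      linarith [hω2 n]
    have hch : ∀ t : Set.range ω, ∃ v : 𝓗,
        Module.End.HasEigenvector (H : 𝓗 →ₗ[ℂ] 𝓗) ((t : ℝ) : ℂ) v := by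
      rintro ⟨_, n, rfl⟩
      exact (hω3 n).exists_hasEigenvector
    choose v hv using hch
    have hli : LinearIndependent ℂ v :=
      Module.End.eigenvectors_linearIndependent' (H : 𝓗 →ₗ[ℂ] 𝓗) (fun t : Set.range ω => ((t : ℝ) : ℂ))
        (fun a b h => Subtype.ext (Complex.ofReal_injective h)) v hv
    have hvm : ∀ t, v t ∈ eigBelow H E := by
      intro t
      have ht : (t : ℝ) < E := by
        obtain ⟨_, n, rfl⟩ := t
        exact hω2 n
      exact Submodule.mem_iSup_of_mem (p := fun t : {t : ℝ // t < E} =>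
        Module.End.eigenspace (H : 𝓗 →ₗ[ℂ] 𝓗) ((t : ℝ) : ℂ)) ⟨t, ht⟩ (hv t).1
    have hli2 : LinearIndependent ℂ (fun t => (⟨v t, hvm t⟩ : eigBelow H E)) :=
      LinearIndependent.of_comp (eigBelow H E).subtype hli
    have : Finite (Set.range ω) := hli2.finite
    exact hinf (Set.toFinite _)

end Abstract

section Elementary

lemma p_lt_succ (n : ℕ) : p n < p (n + 1) := by
  have : (0 : ℝ) < (1 / 2 : ℝ) ^ n := by positivity
  simp only [p, pow_succ]; linarith

lemma p_mono {m n : ℕ} (h : m ≤ n) : p m ≤ p n :=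
  monotone_nat_of_le_succ (fun n => (p_lt_succ n).le) h

lemma p_nonneg (n : ℕ) : 0 ≤ p n := by
  have := p_mono (Nat.zero_le n)
  simpa [p] using this

lemma p_lt_one (n : ℕ) : p n < 1 := by
  have : (0 : ℝ) < (1 / 2 : ℝ) ^ n := by positivity
  simp only [p]; linarith

lemma p_sub (n : ℕ) : p (n + 1) - p n = (1 / 2 : ℝ) ^ (n + 1) := by
  simp only [p, pow_succ]; ring

/-- The interval `[pₙ, pₙ₊₁]`. -/
def In (n : ℕ) : Set ℝ := Set.Icc (p n) (p (n + 1))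

lemma measurableSet_In (n : ℕ) : MeasurableSet (In n) := measurableSet_Icc

/-- Shifted `φ`. -/
def phi (n : ℕ) (y : ℝ) : ℝ := φ (n + 1) y

lemma phi_def (n : ℕ) (y : ℝ) : φ (n + 1) y = phi n y := rfl

lemma phi_not_mem {n : ℕ} {y : ℝ} (h : y ∉ In n) : phi n y = 0 := by
  have : ξ (n + 1) y = 0 := by
    simp only [ξ, Nat.add_sub_cancel]
    rw [if_neg (show ¬ y ∈ Set.Icc _ _ from h)]
  simp [phi, φ, this]

lemma phi_mem {n : ℕ} {y : ℝ} (h : y ∈ In n) :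
    phi n y = 2 ^ (((n : ℝ) + 2) / 2) * Real.sin (Real.pi * (y - p n) / (p (n + 1) - p n)) := by
  have : ξ (n + 1) y = Real.pi * (y - p n) / (p (n + 1) - p n) := by
    simp only [ξ, Nat.add_sub_cancel]
    rw [if_pos (show y ∈ Set.Icc _ _ from h)]
  simp only [phi, φ, this]
  push_cast
  ring_nf

lemma phi_left (n : ℕ) : phi n (p n) = 0 := by
  rw [phi_mem ⟨le_rfl, (p_lt_succ n).le⟩]; simp

lemma phi_right (n : ℕ) : phi n (p (n + 1)) = 0 := by
  rw [phi_mem ⟨(p_lt_succ n).le, le_rfl⟩,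
    mul_div_cancel_right₀ _ (sub_pos.mpr (p_lt_succ n)).ne']; simp

lemma mem_In_eq {m n : ℕ} {y : ℝ} (hmn : m ≠ n) (hm : y ∈ In m) (hn : y ∈ In n) :
    (y = p n ∨ y = p (n + 1)) ∧ (y = p m ∨ y = p (m + 1)) := by
  rcases lt_or_gt_of_ne hmn with h | h
  · have h1 := p_mono (show m + 1 ≤ n from h)
    have h2 := hm.2; have h3 := hn.1
    exact ⟨Or.inl (by linarith), Or.inr (by linarith)⟩
  · have h1 := p_mono (show n + 1 ≤ m from h)
    have h2 := hm.1; have h3 := hn.2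
    exact ⟨Or.inr (by linarith), Or.inl (by linarith)⟩

lemma phi_ne {m n : ℕ} {y : ℝ} (hmn : m ≠ n) (hn : y ∈ In n) : phi m y = 0 := by
  by_cases hm : y ∈ In m
  · rcases (mem_In_eq hmn hm hn).2 with h | h
    · rw [h, phi_left]
    · rw [h, phi_right]
  · exact phi_not_mem hm

lemma phi_mul_phi {m n : ℕ} (hmn : m ≠ n) (y : ℝ) : phi m y * phi n y = 0 := by
  by_cases hn : y ∈ In n
  · rw [phi_ne hmn hn, zero_mul]
  · rw [phi_not_mem hn, mul_zero]

lemma k₂_mem {n : ℕ} {y : ℝ} (hy : y ∈ In n) (t : ℝ) :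
    k₂ y t = (2 / 3 : ℝ) ^ (n + 1) * phi n y * phi n t := by
  rw [k₂, tsum_eq_single n]
  · rfl
  · intro m hm
    rw [phi_def, phi_ne hm hy]; ring

lemma exists_In {y : ℝ} (h0 : 0 ≤ y) (h1 : y < 1) : ∃ n, y ∈ In n := by
  obtain ⟨n, hn1, hn2⟩ := exists_nat_pow_near_of_lt_one (x := 1 - y) (y := (1 / 2 : ℝ))
    (by linarith) (by linarith) (by norm_num) (by norm_num)
  refine ⟨n, ?_, ?_⟩ <;> simp only [p] <;> linarith

lemma measurable_phi (n : ℕ) : Measurable (phi n) := by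
  have hξ : Measurable (ξ (n + 1)) := by
    unfold ξ
    refine Measurable.ite measurableSet_Icc ?_ measurable_const
    fun_prop
  unfold phi φ
  exact (Real.measurable_sin.comp hξ).const_mul _

lemma abs_phi_le (n : ℕ) (y : ℝ) : |phi n y| ≤ 2 ^ ((((n + 1 : ℕ) : ℝ) + 1) / 2) := by
  unfold phi φ
  rw [abs_mul, abs_of_pos (by positivity)]
  exact mul_le_of_le_one_right (by positivity) (Real.abs_sin_le_one _)

instance : IsProbabilityMeasure μI := ⟨by simp [μI]⟩

instance : IsProbabilityMeasure μI2 := by unfold μI2; infer_instance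

lemma integral_phi_sq (n : ℕ) : ∫ y, phi n y * phi n y ∂μI = 1 := by
  have h1 : ∀ y, phi n y * phi n y = (In n).indicator (fun y => (2 : ℝ) ^ (n + 2) *
      (Real.sin ((Real.pi * 2 ^ (n + 1)) * y - (Real.pi * 2 ^ (n + 1)) * p n)) ^ 2) y := by
    intro y
    by_cases hy : y ∈ In n
    · rw [Set.indicator_of_mem hy, phi_mem hy, p_sub]
      have e1 : ((2 : ℝ) ^ (((n : ℝ) + 2) / 2)) * (2 : ℝ) ^ (((n : ℝ) + 2) / 2) = 2 ^ (n + 2) := by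
        rw [← Real.rpow_add two_pos, ← Real.rpow_natCast]
        congr 1; push_cast; ring
      have e2 : Real.pi * (y - p n) / (1 / 2) ^ (n + 1)
          = (Real.pi * 2 ^ (n + 1)) * y - (Real.pi * 2 ^ (n + 1)) * p n := by
        rw [one_div, inv_pow, div_inv_eq_mul]; ring
      rw [e2, ← e1]; ring
    · rw [Set.indicator_of_notMem hy, phi_not_mem hy, zero_mul]
  simp_rw [h1]
  have hsub : In n ⊆ Set.Icc 0 1 := Set.Icc_subset_Icc (p_nonneg n) (p_lt_one _).le
  have hpi := Real.pi_pos
  have hc : (Real.pi * 2 ^ (n + 1) : ℝ) ≠ 0 := by positivity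
  rw [integral_indicator (measurableSet_In n), μI, Measure.restrict_restrict (measurableSet_In n),
    Set.inter_eq_left.mpr hsub, In, integral_Icc_eq_integral_Ioc,
    ← intervalIntegral.integral_of_le (p_lt_succ n).le, intervalIntegral.integral_const_mul,
    intervalIntegral.integral_comp_mul_sub (fun z => Real.sin z ^ 2) hc, sub_self, ← mul_sub,
    p_sub, integral_sin_sq]
  have e3 : Real.pi * 2 ^ (n + 1) * (1 / 2) ^ (n + 1) = Real.pi := by
    rw [mul_assoc, ← mul_pow]; norm_num
  rw [e3]
  simp only [Real.sin_zero, Real.sin_pi, smul_eq_mul]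
  field_simp
  ring

lemma ae_mem_In : ∀ᵐ y ∂μI, ∃ n, y ∈ In n := by
  have h1 : ∀ᵐ y ∂μI, y ∈ Set.Icc (0 : ℝ) 1 := ae_restrict_mem measurableSet_Icc
  have h2 : ∀ᵐ y ∂μI, y ≠ 1 := by
    refine ae_restrict_of_ae ?_
    exact Measure.ae_ne volume 1
  filter_upwards [h1, h2] with y hy hne
  exact exists_In hy.1 (lt_of_le_of_ne hy.2 hne)

lemma r_nonneg (n : ℕ) (x : ℝ) : 0 ≤ r (n + 1) x := by
  have h := p_lt_succ n
  unfold r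
  simp only [Nat.add_sub_cancel, q]
  split_ifs with h1 h2
  · exact div_nonneg (by linarith [h1.1]) (by linarith)
  · exact div_nonneg (by linarith [h2.2]) (by linarith)
  · exact le_rfl

lemma r_le_one (n : ℕ) (x : ℝ) : r (n + 1) x ≤ 1 := by
  have h := p_lt_succ n
  unfold r
  simp only [Nat.add_sub_cancel, q]
  split_ifs with h1 h2
  · exact (div_le_one (by linarith)).mpr (by linarith [h1.2])
  · exact (div_le_one (by linarith)).mpr (by linarith [h2.1])
  · exact zero_le_one

lemma r_not_mem {n : ℕ} {x : ℝ} (hx : x ∉ In n) : r (n + 1) x = 0 := by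
  have h := p_lt_succ n
  unfold r
  simp only [Nat.add_sub_cancel, q]
  split_ifs with h1 h2
  · exact absurd ⟨h1.1, by linarith [h1.2]⟩ hx
  · exact absurd ⟨by linarith [h2.1], h2.2⟩ hx
  · rfl

lemma r_ne {m n : ℕ} {x : ℝ} (hmn : m ≠ n) (hx : x ∈ In n) : r (m + 1) x = 0 := by
  by_cases hm : x ∈ In m
  · have h := p_lt_succ m
    unfold r
    simp only [Nat.add_sub_cancel, q]
    rcases (mem_In_eq hmn hm hx).2 with rfl | rfl
    · rw [if_pos ⟨le_rfl, by linarith⟩]; simp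
    · rw [if_neg (by rintro ⟨-, h2⟩; linarith), if_pos ⟨by linarith, le_rfl⟩]; simp
  · exact r_not_mem hm

lemma u_nonneg {δ : ℕ → ℝ} (hδ₁ : δ 1 = 1)
    (hδ : ∀ n : ℕ, 2 ≤ n → 0 ≤ δ n ∧ δ n ≤ (Real.sqrt 2 / 3) ^ n) (x : ℝ) : 0 ≤ u δ x := by
  unfold u
  split_ifs with h
  · exact le_rfl
  · refine tsum_nonneg fun n => mul_nonneg ?_ (r_nonneg n x)
    rcases Nat.eq_zero_or_pos n with rfl | hn
    · rw [zero_add, hδ₁]; exact zero_le_one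
    · exact (hδ (n + 1) (by omega)).1

lemma sqrt_lt : Real.sqrt 2 / 3 < 2 / 3 := by
  have : Real.sqrt 2 < 2 := by
    rw [Real.sqrt_lt' (by norm_num)]; norm_num
  linarith

lemma u_le {δ : ℕ → ℝ}
    (hδ : ∀ n : ℕ, 2 ≤ n → 0 ≤ δ n ∧ δ n ≤ (Real.sqrt 2 / 3) ^ n) {n : ℕ} {x : ℝ}
    (hx : x ∈ In n) : u δ x ≤ (Real.sqrt 2 / 3) ^ (n + 1) := by
  unfold u
  split_ifs with h
  · positivity
  · have hn : n ≠ 0 := by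
      rintro rfl
      have := hx.2
      norm_num [p] at this
      norm_num at h
      linarith
    rw [tsum_eq_single n (fun m hm => by rw [r_ne hm hx, mul_zero])]
    have h2 := hδ (n + 1) (by omega)
    exact (mul_le_of_le_one_right h2.1 (r_le_one n x)).trans h2.2

lemma uu_le {δ : ℕ → ℝ} (hδ₁ : δ 1 = 1)
    (hδ : ∀ n : ℕ, 2 ≤ n → 0 ≤ δ n ∧ δ n ≤ (Real.sqrt 2 / 3) ^ n) {m n : ℕ} {x y : ℝ}
    (hx : x ∈ In m) (hy : y ∈ In n) : u δ x * u δ y ≤ (Real.sqrt 2 / 3) ^ (n + 1) := by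
  have h1 : u δ x ≤ 1 := (u_le hδ hx).trans (pow_le_one₀ (by positivity) (by linarith [sqrt_lt]))
  exact (mul_le_of_le_one_left (u_nonneg hδ₁ hδ y) h1).trans (u_le hδ hy)

end Elementary

section Operators

open ComplexConjugate

/-- The Hilbert space. -/
abbrev L2sq := Lp ℂ 2 μI2

lemma measurableSet_strip (n : ℕ) : MeasurableSet {z : ℝ × ℝ | z.2 ∈ In n} :=
  measurable_snd (measurableSet_In n)

/-- Multiplication by the indicator of `{y ∈ In n}`. -/
def Mop (n : ℕ) : L2sq →L[ℂ] L2sq :=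
  LinearMap.mkContinuous
    { toFun := fun f => ((Lp.memLp f).indicator (measurableSet_strip n)).toLp _
      map_add' := by
        intro f g
        rw [← MemLp.toLp_add]
        apply MemLp.toLp_congr
        filter_upwards [Lp.coeFn_add f g] with z hz
        rw [Pi.add_apply] at hz ⊢
        by_cases h : z ∈ {z : ℝ × ℝ | z.2 ∈ In n}
        · rw [Set.indicator_of_mem h, Set.indicator_of_mem h, Set.indicator_of_mem h, hz]
        · rw [Set.indicator_of_notMem h, Set.indicator_of_notMem h, Set.indicator_of_notMem h,
            add_zero]
      map_smul' := by
        intro c f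
        rw [RingHom.id_apply, ← MemLp.toLp_const_smul]
        apply MemLp.toLp_congr
        filter_upwards [Lp.coeFn_smul c f] with z hz
        by_cases h : z ∈ {z : ℝ × ℝ | z.2 ∈ In n} <;> simp [h, hz] } 1 (by
    intro f
    rw [one_mul]
    apply Lp.norm_le_norm_of_ae_le
    filter_upwards [((Lp.memLp f).indicator (measurableSet_strip n)).coeFn_toLp] with z hz
    simp only [LinearMap.coe_mk, AddHom.coe_mk]
    rw [hz]
    exact norm_indicator_le_norm_self _ _)

lemma Mop_coe (n : ℕ) (f : L2sq) :
    (Mop n f : ℝ × ℝ → ℂ) =ᵐ[μI2] {z : ℝ × ℝ | z.2 ∈ In n}.indicator f :=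
  ((Lp.memLp f).indicator (measurableSet_strip n)).coeFn_toLp

/-- The partial inner product with `phi n`. -/
def cc (n : ℕ) (f : ℝ × ℝ → ℂ) (x : ℝ) : ℂ := ∫ t, (phi n t : ℂ) * f (x, t) ∂μI

/-- `S` is the operator `I ⊗ |φₙ⟩⟨φₙ|`. -/
def IsS (n : ℕ) (S : L2sq →L[ℂ] L2sq) : Prop :=
  ∀ f : L2sq, (S f : ℝ × ℝ → ℂ) =ᵐ[μI2] fun z => (phi n z.2 : ℂ) * cc n f z.1

lemma exists_S (T₂ : L2sq →L[ℂ] L2sq)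
    (hT₂ : ∀ f : Lp ℂ 2 μI2,
      (T₂ f : ℝ × ℝ → ℂ) =ᵐ[μI2] fun xy => ∫ t, (k₂ xy.2 t : ℂ) * f (xy.1, t) ∂μI) (n : ℕ) :
    ∃ S, IsS n S := by
  refine ⟨((3 / 2 : ℂ) ^ (n + 1)) • (Mop n ∘L T₂), fun f => ?_⟩
  filter_upwards [Lp.coeFn_smul ((3 / 2 : ℂ) ^ (n + 1)) (Mop n (T₂ f)), Mop_coe n (T₂ f), hT₂ f]
    with z h1 h2 h3
  rw [smul_apply, ContinuousLinearMap.comp_apply, h1, Pi.smul_apply, h2, smul_eq_mul]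
  by_cases hz : z ∈ {z : ℝ × ℝ | z.2 ∈ In n}
  · rw [Set.indicator_of_mem hz, h3, cc, ← integral_const_mul, ← integral_const_mul]
    congr 1
    funext t
    rw [k₂_mem hz]
    push_cast
    have : (3 / 2 : ℂ) ^ (n + 1) * (2 / 3) ^ (n + 1) = 1 := by
      rw [← mul_pow]; norm_num
    linear_combination (phi n z.2 : ℂ) * phi n t * f (z.1, t) * this
  · rw [Set.indicator_of_notMem hz, phi_not_mem hz]; simp

lemma inner_eq_integral (g : L2sq) {f : L2sq} {F : ℝ × ℝ → ℂ} (h : (f : ℝ × ℝ → ℂ) =ᵐ[μI2] F) :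
    Integrable (fun z => conj (g z) * F z) μI2 ∧
    inner ℂ g f = ∫ z, conj (g z) * F z ∂μI2 := by
  have h1 : (fun z => inner ℂ (g z) (f z)) =ᵐ[μI2] fun z => conj (g z) * F z := by
    filter_upwards [h] with z hz
    rw [RCLike.inner_apply, hz, mul_comm]
  exact ⟨(L2.integrable_inner g f).congr h1, by rw [L2.inner_def]; exact integral_congr_ae h1⟩

lemma S_inner {n : ℕ} {S : L2sq →L[ℂ] L2sq} (hS : IsS n S) (g f : L2sq) :
    inner ℂ g (S f) = ∫ x, conj (cc n g x) * cc n f x ∂μI := by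
  obtain ⟨hi, he⟩ := inner_eq_integral g (hS f)
  rw [he]
  unfold μI2 at hi ⊢
  rw [integral_prod _ hi]
  congr 1
  funext x
  rw [cc, ← integral_conj, ← integral_mul_const]
  congr 1
  funext y
  simp only [map_mul, Complex.conj_ofReal]
  ring

lemma S_symm {n : ℕ} {S : L2sq →L[ℂ] L2sq} (hS : IsS n S) (g f : L2sq) :
    inner ℂ (S g) f = inner ℂ g (S f) := by
  rw [← inner_conj_symm, S_inner hS, S_inner hS, ← integral_conj]
  congr 1
  funext x
  simp [mul_comm]

lemma cc_congr (n : ℕ) {f g : ℝ × ℝ → ℂ} (h : f =ᵐ[μI2] g) : cc n f =ᵐ[μI] cc n g := by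
  have h1 := Measure.ae_ae_of_ae_prod h
  filter_upwards [h1] with x hx
  refine integral_congr_ae ?_
  filter_upwards [hx] with t ht
  rw [ht]

lemma ae_fst {P : ℝ → Prop} (h : ∀ᵐ x ∂μI, P x) : ∀ᵐ z ∂μI2, P z.1 :=
  Measure.quasiMeasurePreserving_fst.ae h

lemma ae_snd {P : ℝ → Prop} (h : ∀ᵐ x ∂μI, P x) : ∀ᵐ z ∂μI2, P z.2 :=
  Measure.quasiMeasurePreserving_snd.ae h

lemma cc_phi (m n : ℕ) (F : ℝ → ℂ) (x : ℝ) :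
    cc m (fun z => (phi n z.2 : ℂ) * F z.1) x = if m = n then F x else 0 := by
  unfold cc
  split_ifs with h
  · subst h
    have : ∀ t, (phi m t : ℂ) * ((phi m t : ℂ) * F x) = ((phi m t * phi m t : ℝ) : ℂ) * F x :=
      fun t => by push_cast; ring
    simp only [this]
    rw [integral_mul_const, integral_complex_ofReal, integral_phi_sq]; simp
  · have : ∀ t, (phi m t : ℂ) * ((phi n t : ℂ) * F x) = 0 :=
      fun t => by rw [← mul_assoc, ← Complex.ofReal_mul, phi_mul_phi h]; simp
    simp only [this, integral_zero]

lemma cc_phi_one (m n : ℕ) (x : ℝ) :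
    cc m (fun z => (phi n z.2 : ℂ)) x = if m = n then 1 else 0 := by
  have := cc_phi m n (fun _ => 1) x
  simpa using this

lemma S_comp {m n : ℕ} {S S' : L2sq →L[ℂ] L2sq} (hS : IsS m S) (hS' : IsS n S') (f : L2sq) :
    S (S' f) = if m = n then S' f else 0 := by
  apply Lp.ext
  filter_upwards [hS (S' f), hS' f, ae_fst (cc_congr m (hS' f)), Lp.coeFn_zero ℂ 2 μI2]
    with z h1 h2 h3 h4
  rw [h1, h3, cc_phi]
  split_ifs with h
  · subst h; rw [h2]
  · rw [h4]; simp

/-- `eₙ = 1 ⊗ φₙ`. -/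
lemma memLp_en (n : ℕ) : MemLp (fun z : ℝ × ℝ => (phi n z.2 : ℂ)) 2 μI2 := by
  refine MemLp.of_bound (C := 2 ^ ((((n + 1 : ℕ) : ℝ) + 1) / 2)) ?_ (Eventually.of_forall fun z => ?_)
  · exact (Complex.measurable_ofReal.comp ((measurable_phi n).comp measurable_snd)).aestronglyMeasurable
  · rw [Complex.norm_real]; exact abs_phi_le n z.2

def en (n : ℕ) : L2sq := (memLp_en n).toLp _

lemma en_coe (n : ℕ) : (en n : ℝ × ℝ → ℂ) =ᵐ[μI2] fun z => (phi n z.2 : ℂ) :=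
  (memLp_en n).coeFn_toLp

lemma inner_en (n : ℕ) (f : L2sq) : inner ℂ (en n) f = ∫ x, cc n f x ∂μI := by
  obtain ⟨hi, he⟩ := inner_eq_integral (en n) (f := f) (F := f) (ae_eq_refl _)
  have h1 : (fun z => conj (en n z) * f z) =ᵐ[μI2] fun z => (phi n z.2 : ℂ) * f z := by
    filter_upwards [en_coe n] with z hz
    rw [hz, Complex.conj_ofReal]
  have hi2 := hi.congr h1
  rw [he, integral_congr_ae h1]
  unfold μI2 at hi2 ⊢
  rw [integral_prod _ hi2]
  rfl

lemma S_en {m n : ℕ} {S : L2sq →L[ℂ] L2sq} (hS : IsS m S) :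
    S (en n) = if m = n then en n else 0 := by
  apply Lp.ext
  filter_upwards [hS (en n), en_coe n, ae_fst (cc_congr m (en_coe n)), Lp.coeFn_zero ℂ 2 μI2]
    with z h1 h2 h3 h4
  rw [h1, h3, cc_phi_one]
  split_ifs with h
  · subst h; rw [h2]; simp
  · rw [h4]; simp

lemma inner_en_en (m n : ℕ) : inner ℂ (en m) (en n) = if m = n then 1 else 0 := by
  rw [inner_en, integral_congr_ae (cc_congr m (en_coe n))]
  simp only [cc_phi_one]
  simp

/-- ae statements in the swapped order. -/
lemma ae_swap {P : ℝ × ℝ → Prop} (h : ∀ᵐ z ∂μI2, P z) : ∀ᵐ y ∂μI, ∀ᵐ x ∂μI, P (x, y) := by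
  have h1 : ∀ᵐ z ∂(μI.prod μI), P z.swap :=
    (Measure.measurePreserving_swap (μ := μI) (ν := μI)).quasiMeasurePreserving.ae h
  exact Measure.ae_ae_of_ae_prod h1

/-- Partial integral. -/
def dd (f : ℝ × ℝ → ℂ) (y : ℝ) : ℂ := ∫ s, f (s, y) ∂μI

lemma dd_congr {f g : ℝ × ℝ → ℂ} (h : f =ᵐ[μI2] g) : dd f =ᵐ[μI] dd g := by
  filter_upwards [ae_swap h] with x hx
  exact integral_congr_ae hx

section T1

lemma T₁_inner (T₁ : L2sq →L[ℂ] L2sq)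
    (hT₁ : ∀ f : Lp ℂ 2 μI2, (T₁ f : ℝ × ℝ → ℂ) =ᵐ[μI2] fun xy => ∫ s, f (s, xy.2) ∂μI)
    (g f : L2sq) : inner ℂ g (T₁ f) = ∫ y, conj (dd g y) * dd f y ∂μI := by
  obtain ⟨hi, he⟩ := inner_eq_integral g (hT₁ f)
  rw [he]
  unfold μI2 at hi ⊢
  rw [integral_prod_symm _ hi]
  congr 1
  funext y
  rw [dd, ← integral_conj, ← integral_mul_const]
  rfl

lemma T₁_symm (T₁ : L2sq →L[ℂ] L2sq)
    (hT₁ : ∀ f : Lp ℂ 2 μI2, (T₁ f : ℝ × ℝ → ℂ) =ᵐ[μI2] fun xy => ∫ s, f (s, xy.2) ∂μI)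
    (g f : L2sq) : inner ℂ (T₁ g) f = inner ℂ g (T₁ f) := by
  rw [← inner_conj_symm, T₁_inner T₁ hT₁, T₁_inner T₁ hT₁, ← integral_conj]
  congr 1
  funext x
  simp [mul_comm]

lemma T₁_idem (T₁ : L2sq →L[ℂ] L2sq)
    (hT₁ : ∀ f : Lp ℂ 2 μI2, (T₁ f : ℝ × ℝ → ℂ) =ᵐ[μI2] fun xy => ∫ s, f (s, xy.2) ∂μI)
    (f : L2sq) : T₁ (T₁ f) = T₁ f := by
  apply Lp.ext
  filter_upwards [hT₁ (T₁ f), hT₁ f, ae_snd (dd_congr (hT₁ f))] with z h1 h2 h3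
  rw [h1, h2]
  refine h3.trans ?_
  simp [dd]

lemma T₁_S (T₁ : L2sq →L[ℂ] L2sq)
    (hT₁ : ∀ f : Lp ℂ 2 μI2, (T₁ f : ℝ × ℝ → ℂ) =ᵐ[μI2] fun xy => ∫ s, f (s, xy.2) ∂μI)
    {n : ℕ} {S : L2sq →L[ℂ] L2sq} (hS : IsS n S) (f : L2sq) :
    T₁ (S f) = (inner ℂ (en n) f) • en n := by
  apply Lp.ext
  filter_upwards [hT₁ (S f), ae_snd (dd_congr (hS f)), en_coe n,
    Lp.coeFn_smul (inner ℂ (en n) f) (en n)] with z h1 h2 h3 h4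
  rw [h1, h4, Pi.smul_apply, h3, inner_en, smul_eq_mul, mul_comm]
  refine h2.trans ?_
  simp only [dd]
  rw [integral_const_mul]

lemma T₁_en (T₁ : L2sq →L[ℂ] L2sq)
    (hT₁ : ∀ f : Lp ℂ 2 μI2, (T₁ f : ℝ × ℝ → ℂ) =ᵐ[μI2] fun xy => ∫ s, f (s, xy.2) ∂μI)
    (n : ℕ) : T₁ (en n) = en n := by
  apply Lp.ext
  filter_upwards [hT₁ (en n), ae_snd (dd_congr (en_coe n)), en_coe n] with z h1 h2 h3
  rw [h1, h3]
  refine h2.trans ?_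
  simp [dd]

lemma S_T₁ (T₁ : L2sq →L[ℂ] L2sq)
    (hT₁ : ∀ f : Lp ℂ 2 μI2, (T₁ f : ℝ × ℝ → ℂ) =ᵐ[μI2] fun xy => ∫ s, f (s, xy.2) ∂μI)
    {n : ℕ} {S : L2sq →L[ℂ] L2sq} (hS : IsS n S) (f : L2sq) :
    S (T₁ f) = T₁ (S f) := by
  refine ext_inner_right ℂ fun g => ?_
  rw [S_symm hS, T₁_symm T₁ hT₁, T₁_S T₁ hT₁ hS, T₁_S T₁ hT₁ hS, inner_smul_left, inner_smul_right,
    inner_conj_symm, mul_comm]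

end T1

end Operators

section Summation

lemma proj_re (P : 𝓗 →L[ℂ] 𝓗) (hs : ∀ f g, inner ℂ (P f) g = inner ℂ f (P g))
    (hi : ∀ f, P (P f) = P f) (f : 𝓗) : (inner ℂ f (P f)).re = ‖P f‖ ^ 2 := by
  have h : inner ℂ f (P f) = inner ℂ (P f) (P f) := by rw [hs, hi]
  rw [h, inner_self_eq_norm_sq_to_K]
  norm_cast

lemma proj_norm_le (P : 𝓗 →L[ℂ] 𝓗) (hs : ∀ f g, inner ℂ (P f) g = inner ℂ f (P g))
    (hi : ∀ f, P (P f) = P f) (f : 𝓗) : ‖P f‖ ≤ ‖f‖ := by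
  have h1 := proj_re P hs hi f
  have h2 : (inner ℂ f (P f)).re ≤ ‖f‖ * ‖P f‖ := by
    exact re_inner_le_norm (𝕜 := ℂ) f (P f)
  rcases (norm_nonneg (P f)).eq_or_lt with h | h
  · rw [← h]; exact norm_nonneg f
  · nlinarith

/-- Partial sums. -/
def TN (S : ℕ → 𝓗 →L[ℂ] 𝓗) (N : ℕ) : 𝓗 →L[ℂ] 𝓗 :=
  ∑ n ∈ Finset.range N, (((2 / 3 : ℝ) ^ (n + 1) : ℝ) : ℂ) • S n

lemma TN_apply (S : ℕ → 𝓗 →L[ℂ] 𝓗) (N : ℕ) (f : 𝓗) :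
    TN S N f = ∑ n ∈ Finset.range N, (((2 / 3 : ℝ) ^ (n + 1) : ℝ) : ℂ) • S n f := by
  simp [TN]

lemma S_norm_le (S : ℕ → 𝓗 →L[ℂ] 𝓗) (hs : ∀ n f g, inner ℂ (S n f) g = inner ℂ f (S n g))
    (hc : ∀ m n f, S m (S n f) = if m = n then S n f else 0) (n : ℕ) : ‖S n‖ ≤ 1 := by
  refine ContinuousLinearMap.opNorm_le_bound _ zero_le_one fun f => ?_
  rw [one_mul]
  exact proj_norm_le _ (hs n) (fun f => by simpa using hc n n f) f

lemma exists_TN_lim [CompleteSpace 𝓗] (S : ℕ → 𝓗 →L[ℂ] 𝓗)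
    (hs : ∀ n f g, inner ℂ (S n f) g = inner ℂ f (S n g))
    (hc : ∀ m n f, S m (S n f) = if m = n then S n f else 0) :
    ∃ T, Tendsto (TN S) atTop (𝓝 T) := by
  have hsum : Summable fun n : ℕ => (((2 / 3 : ℝ) ^ (n + 1) : ℝ) : ℂ) • S n := by
    refine Summable.of_norm_bounded (g := fun n : ℕ => (2 / 3 : ℝ) ^ (n + 1)) ?_ fun n => ?_
    · exact (summable_nat_add_iff 1).2 (summable_geometric_of_lt_one (by norm_num) (by norm_num))
    · rw [norm_smul, Complex.norm_real, Real.norm_of_nonneg (by positivity)]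
      exact mul_le_of_le_one_right (by positivity) (S_norm_le S hs hc n)
  exact ⟨_, hsum.hasSum.tendsto_sum_nat⟩

lemma apply_tendsto {A : ℕ → 𝓗 →L[ℂ] 𝓗} {T : 𝓗 →L[ℂ] 𝓗} (h : Tendsto A atTop (𝓝 T)) (f : 𝓗) :
    Tendsto (fun N => A N f) atTop (𝓝 (T f)) :=
  ((ContinuousLinearMap.apply ℂ 𝓗 f).continuous.tendsto T).comp h

lemma T_symm (S : ℕ → 𝓗 →L[ℂ] 𝓗) (hs : ∀ n f g, inner ℂ (S n f) g = inner ℂ f (S n g))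
    {T : 𝓗 →L[ℂ] 𝓗} (hT : Tendsto (TN S) atTop (𝓝 T)) (f g : 𝓗) :
    inner ℂ (T f) g = inner ℂ f (T g) := by
  have h1 : Tendsto (fun N => inner ℂ (TN S N f) g) atTop (𝓝 (inner ℂ (T f) g)) :=
    (apply_tendsto hT f).inner tendsto_const_nhds
  have h2 : Tendsto (fun N => inner ℂ f (TN S N g)) atTop (𝓝 (inner ℂ f (T g))) :=
    tendsto_const_nhds.inner (apply_tendsto hT g)
  refine tendsto_nhds_unique h1 (h2.congr fun N => ?_)
  rw [TN_apply, TN_apply, sum_inner, inner_sum]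
  refine Finset.sum_congr rfl fun n _ => ?_
  rw [inner_smul_left, inner_smul_right, hs, Complex.conj_ofReal]

lemma T_form_le (S : ℕ → 𝓗 →L[ℂ] 𝓗) (hs : ∀ n f g, inner ℂ (S n f) g = inner ℂ f (S n g))
    (hc : ∀ m n f, S m (S n f) = if m = n then S n f else 0)
    {T : 𝓗 →L[ℂ] 𝓗} (hT : Tendsto (TN S) atTop (𝓝 T)) (f : 𝓗) :
    (inner ℂ f (T f)).re ≤ 2 / 3 * ‖f‖ ^ 2 := by
  have h2 : Tendsto (fun N => (inner ℂ f (TN S N f)).re) atTop (𝓝 (inner ℂ f (T f)).re) :=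
    (Complex.continuous_re.tendsto _).comp (tendsto_const_nhds.inner (apply_tendsto hT f))
  refine le_of_tendsto h2 (Eventually.of_forall fun N => ?_)
  have hS : ∀ n, (inner ℂ f (S n f)).re = ‖S n f‖ ^ 2 :=
    fun n => proj_re _ (hs n) (fun f => by simpa using hc n n f) f
  set P : 𝓗 →L[ℂ] 𝓗 := ∑ n ∈ Finset.range N, S n with hP
  have hPa : ∀ f, P f = ∑ n ∈ Finset.range N, S n f := fun f => by simp [hP]
  have hPs : ∀ f g, inner ℂ (P f) g = inner ℂ f (P g) := by
    intro f g
    rw [hPa, hPa, sum_inner, inner_sum]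
    exact Finset.sum_congr rfl fun n _ => hs n f g
  have hPi : ∀ f, P (P f) = P f := by
    intro f
    rw [hPa (P f), hPa f]
    refine Finset.sum_congr rfl fun n hn => ?_
    rw [map_sum]
    simp only [hc]
    rw [Finset.sum_ite_eq, if_pos hn]
  have h3 := proj_re P hPs hPi f
  have h4 := proj_norm_le P hPs hPi f
  rw [hPa f, inner_sum, Complex.re_sum, ← hPa f] at h3
  rw [TN_apply, inner_sum, Complex.re_sum]
  calc _ ≤ ∑ n ∈ Finset.range N, 2 / 3 * (inner ℂ f (S n f)).re := by
        refine Finset.sum_le_sum fun n _ => ?_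
        rw [inner_smul_right, Complex.re_ofReal_mul]
        refine mul_le_mul_of_nonneg_right ?_ (by rw [hS]; positivity)
        have : (2 / 3 : ℝ) ^ n ≤ 1 := pow_le_one₀ (by norm_num) (by norm_num)
        rw [pow_succ]; linarith
    _ = 2 / 3 * ‖P f‖ ^ 2 := by rw [← Finset.mul_sum, h3]
    _ ≤ _ := by
        have := norm_nonneg (P f)
        gcongr

lemma rank_one_compact (v w : 𝓗) :
    IsCompactOperator (((innerSL ℂ v).smulRight w : 𝓗 →L[ℂ] 𝓗)) := by
  have h1 : IsCompactOperator (ContinuousLinearMap.toSpanSingleton ℂ w : ℂ →L[ℂ] 𝓗) :=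
    isCompactOperator_of_locallyCompactSpace_rng _
  exact h1.comp_clm (innerSL ℂ v)

/-- Negativity on a span. -/
lemma neg_form (e : ℕ → 𝓗) (he : ∀ m n, inner ℂ (e m) (e n) = if m = n then (1 : ℂ) else 0)
    (H : 𝓗 →L[ℂ] 𝓗) {E : ℝ} (h0 : ∀ m n, m ≠ n → inner ℂ (e m) (H (e n)) = 0)
    (h1 : ∀ n, (inner ℂ (e n) (H (e n))).re < E) (N : ℕ) :
    ∃ F : (Fin N → ℂ) →ₗ[ℂ] 𝓗, ∀ a, a ≠ 0 → (inner ℂ (F a) (H (F a))).re < E * ‖F a‖ ^ 2 := by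
  refine ⟨Fintype.linearCombination ℂ (fun i : Fin N => e i), fun a ha => ?_⟩
  have key : ∀ A : 𝓗 →L[ℂ] 𝓗, (∀ m n, m ≠ n → inner ℂ (e m) (A (e n)) = 0) →
      (inner ℂ (∑ i : Fin N, a i • e i) (A (∑ i : Fin N, a i • e i))).re
        = ∑ i : Fin N, ‖a i‖ ^ 2 * (inner ℂ (e i) (A (e i))).re := by
    intro A hA
    rw [map_sum, sum_inner, Complex.re_sum]
    refine Finset.sum_congr rfl fun i _ => ?_
    rw [inner_sum, Finset.sum_eq_single i]
    · rw [map_smul, inner_smul_left, inner_smul_right, ← mul_assoc, mul_comm _ (a i),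
        Complex.mul_conj, Complex.re_ofReal_mul, Complex.normSq_eq_norm_sq]
    · intro j _ hj
      rw [map_smul, inner_smul_left, inner_smul_right, hA _ _ (fun h => hj (Fin.ext h).symm)]
      simp
    · simp
  have k1 := key H h0
  have k2 := key (ContinuousLinearMap.id ℂ 𝓗) (fun m n h => by simpa [h] using he m n)
  simp only [ContinuousLinearMap.id_apply, he, if_true, Complex.one_re, mul_one] at k2
  rw [inner_self_eq_norm_sq_to_K] at k2
  have k3 : ‖∑ i : Fin N, a i • e i‖ ^ 2 = ∑ i : Fin N, ‖a i‖ ^ 2 := by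
    rw [← k2]; norm_cast
  rw [Fintype.linearCombination_apply, k1, k3, Finset.mul_sum]
  obtain ⟨i, hi⟩ := Function.ne_iff.1 ha
  refine Finset.sum_lt_sum (fun j _ => ?_) ⟨i, Finset.mem_univ _, ?_⟩
  · rw [mul_comm]; exact mul_le_mul_of_nonneg_right (h1 j).le (by positivity)
  · rw [mul_comm]; exact mul_lt_mul_of_pos_right (h1 i) (by
      have : 0 < ‖a i‖ := norm_pos_iff.2 hi
      positivity)

end Summation

section Final

open ComplexConjugate

lemma TN_coe {S : ℕ → L2sq →L[ℂ] L2sq} (hS : ∀ n, IsS n (S n)) (f : L2sq) (N : ℕ) :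
    (TN S N f : ℝ × ℝ → ℂ) =ᵐ[μI2] fun z => ∑ n ∈ Finset.range N,
      (((2 / 3 : ℝ) ^ (n + 1) * phi n z.2 : ℝ) : ℂ) * cc n f z.1 := by
  induction N with
  | zero =>
    have : TN S 0 f = 0 := by simp [TN]
    rw [this]
    filter_upwards [Lp.coeFn_zero ℂ 2 μI2] with z hz
    rw [hz]; simp
  | succ N ih =>
    have : TN S (N + 1) f = TN S N f + (((2 / 3 : ℝ) ^ (N + 1) : ℝ) : ℂ) • S N f := by
      rw [TN_apply, TN_apply, Finset.sum_range_succ]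
    rw [this]
    filter_upwards [ih, Lp.coeFn_add (TN S N f) ((((2 / 3 : ℝ) ^ (N + 1) : ℝ) : ℂ) • S N f),
      Lp.coeFn_smul (((2 / 3 : ℝ) ^ (N + 1) : ℝ) : ℂ) (S N f), hS N f] with z h1 h2 h3 h4
    rw [h2, Pi.add_apply, h3, Pi.smul_apply, h4, h1, Finset.sum_range_succ, smul_eq_mul]
    push_cast
    ring

lemma T₂_eq (T₂ : L2sq →L[ℂ] L2sq)
    (hT₂ : ∀ f : Lp ℂ 2 μI2,
      (T₂ f : ℝ × ℝ → ℂ) =ᵐ[μI2] fun xy => ∫ t, (k₂ xy.2 t : ℂ) * f (xy.1, t) ∂μI)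
    {S : ℕ → L2sq →L[ℂ] L2sq} (hS : ∀ n, IsS n (S n)) {T : L2sq →L[ℂ] L2sq}
    (hT : Tendsto (TN S) atTop (𝓝 T)) : T = T₂ := by
  refine ContinuousLinearMap.ext fun f => Lp.ext ?_
  obtain ⟨ns, hns, hae⟩ :=
    (tendstoInMeasure_of_tendsto_Lp (apply_tendsto hT f)).exists_seq_tendsto_ae
  filter_upwards [hae, hT₂ f, ae_snd ae_mem_In, ae_all_iff.2 (fun N => TN_coe hS f N)]
    with z h1 h2 h3 h4
  obtain ⟨n, hn⟩ := h3
  refine tendsto_nhds_unique h1 ?_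
  refine tendsto_const_nhds.congr' ?_
  filter_upwards [eventually_gt_atTop n] with i hi
  rw [h4, h2, Finset.sum_eq_single n]
  · rw [cc, ← integral_const_mul]
    congr 1
    funext t
    rw [k₂_mem hn]
    push_cast
    ring
  · intro m _ hm
    rw [phi_ne hm hn]; simp
  · intro h
    exact absurd (Finset.mem_range.2 (hi.trans_le (hns.id_le i))) h

lemma T_en {S : ℕ → L2sq →L[ℂ] L2sq} (hS : ∀ n, IsS n (S n)) {T : L2sq →L[ℂ] L2sq}
    (hT : Tendsto (TN S) atTop (𝓝 T)) (n : ℕ) : T (en n) = (((2 / 3 : ℝ) ^ (n + 1) : ℝ) : ℂ) • en n := by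
  refine tendsto_nhds_unique (apply_tendsto hT (en n)) (tendsto_const_nhds.congr' ?_)
  filter_upwards [eventually_gt_atTop n] with N hN
  rw [TN_apply, Finset.sum_eq_single n]
  · rw [S_en (hS n), if_pos rfl]
  · intro m _ hm
    rw [S_en (hS m), if_neg hm, smul_zero]
  · intro h
    exact absurd (Finset.mem_range.2 hN) h

lemma T₁_comm (T₁ : L2sq →L[ℂ] L2sq)
    (hT₁ : ∀ f : Lp ℂ 2 μI2, (T₁ f : ℝ × ℝ → ℂ) =ᵐ[μI2] fun xy => ∫ s, f (s, xy.2) ∂μI)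
    {S : ℕ → L2sq →L[ℂ] L2sq} (hS : ∀ n, IsS n (S n)) {T : L2sq →L[ℂ] L2sq}
    (hT : Tendsto (TN S) atTop (𝓝 T)) (f : L2sq) : T (T₁ f) = T₁ (T f) := by
  refine tendsto_nhds_unique (apply_tendsto hT (T₁ f)) ?_
  refine ((T₁.continuous.tendsto _).comp (apply_tendsto hT f)).congr fun N => ?_
  rw [Function.comp_apply, TN_apply, TN_apply, map_sum]
  refine Finset.sum_congr rfl fun n _ => ?_
  rw [S_T₁ T₁ hT₁ (hS n), map_smul]

lemma T₁T_compact (T₁ : L2sq →L[ℂ] L2sq)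
    (hT₁ : ∀ f : Lp ℂ 2 μI2, (T₁ f : ℝ × ℝ → ℂ) =ᵐ[μI2] fun xy => ∫ s, f (s, xy.2) ∂μI)
    {S : ℕ → L2sq →L[ℂ] L2sq} (hS : ∀ n, IsS n (S n)) {T : L2sq →L[ℂ] L2sq}
    (hT : Tendsto (TN S) atTop (𝓝 T)) : IsCompactOperator (T₁ ∘L T) := by
  have h1 : Tendsto (fun N => T₁ ∘L TN S N) atTop (𝓝 (T₁ ∘L T)) :=
    ((ContinuousLinearMap.compL ℂ L2sq L2sq L2sq T₁).continuous.tendsto T).comp hT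
  refine isCompactOperator_of_tendsto h1 (Eventually.of_forall fun N => ?_)
  induction N with
  | zero =>
    have : T₁ ∘L TN S 0 = 0 := by simp [TN]
    rw [this]
    exact isCompactOperator_zero
  | succ N ih =>
    have : T₁ ∘L TN S (N + 1) = T₁ ∘L TN S N +
        (((2 / 3 : ℝ) ^ (N + 1) : ℝ) : ℂ) • (innerSL ℂ (en N)).smulRight (en N) := by
      refine ContinuousLinearMap.ext fun f => ?_
      rw [add_apply, ContinuousLinearMap.comp_apply, ContinuousLinearMap.comp_apply,
        TN_apply, TN_apply, Finset.sum_range_succ, map_add,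
        map_smul, T₁_S T₁ hT₁ (hS N)]
      rfl
    rw [this]
    exact ih.add ((rank_one_compact (en N) (en N)).smul _)

section H0

lemma H₀_inner {δ : ℕ → ℝ} (H₀ : L2sq →L[ℂ] L2sq)
    (hH₀ : ∀ f : Lp ℂ 2 μI2,
      (H₀ f : ℝ × ℝ → ℂ) =ᵐ[μI2] fun xy => ((u δ xy.1 * u δ xy.2 : ℝ) : ℂ) * f xy)
    (g f : L2sq) : Integrable (fun z => ((u δ z.1 * u δ z.2 : ℝ) : ℂ) * (conj (g z) * f z)) μI2 ∧
      inner ℂ g (H₀ f) = ∫ z, ((u δ z.1 * u δ z.2 : ℝ) : ℂ) * (conj (g z) * f z) ∂μI2 := by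
  have h := inner_eq_integral g (hH₀ f)
  have : (fun z => conj (g z) * (((u δ z.1 * u δ z.2 : ℝ) : ℂ) * f z)) =
      fun z => ((u δ z.1 * u δ z.2 : ℝ) : ℂ) * (conj (g z) * f z) := by
    funext z; ring
  rwa [this] at h

lemma H₀_symm {δ : ℕ → ℝ} (H₀ : L2sq →L[ℂ] L2sq)
    (hH₀ : ∀ f : Lp ℂ 2 μI2,
      (H₀ f : ℝ × ℝ → ℂ) =ᵐ[μI2] fun xy => ((u δ xy.1 * u δ xy.2 : ℝ) : ℂ) * f xy)
    (g f : L2sq) : inner ℂ (H₀ g) f = inner ℂ g (H₀ f) := by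
  rw [← inner_conj_symm, (H₀_inner H₀ hH₀ _ _).2, (H₀_inner H₀ hH₀ _ _).2, ← integral_conj]
  congr 1
  funext x
  simp only [map_mul, Complex.conj_ofReal, Complex.conj_conj]
  ring

lemma H₀_re {δ : ℕ → ℝ} (H₀ : L2sq →L[ℂ] L2sq)
    (hH₀ : ∀ f : Lp ℂ 2 μI2,
      (H₀ f : ℝ × ℝ → ℂ) =ᵐ[μI2] fun xy => ((u δ xy.1 * u δ xy.2 : ℝ) : ℂ) * f xy)
    (f : L2sq) : Integrable (fun z => u δ z.1 * u δ z.2 * ‖f z‖ ^ 2) μI2 ∧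
      (inner ℂ f (H₀ f)).re = ∫ z, u δ z.1 * u δ z.2 * ‖f z‖ ^ 2 ∂μI2 := by
  have h := H₀_inner H₀ hH₀ f f
  have h2 : (fun z => ((u δ z.1 * u δ z.2 : ℝ) : ℂ) * (conj (f z) * f z)) =
      fun z => ((u δ z.1 * u δ z.2 * ‖f z‖ ^ 2 : ℝ) : ℂ) := by
    funext z
    rw [Complex.conj_mul']
    push_cast
    ring
  rw [h2] at h
  refine ⟨h.1.re, ?_⟩
  rw [h.2, integral_complex_ofReal, Complex.ofReal_re]

lemma H₀_nonneg {δ : ℕ → ℝ} (hδ₁ : δ 1 = 1)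
    (hδ : ∀ n : ℕ, 2 ≤ n → 0 ≤ δ n ∧ δ n ≤ (Real.sqrt 2 / 3) ^ n) (H₀ : L2sq →L[ℂ] L2sq)
    (hH₀ : ∀ f : Lp ℂ 2 μI2,
      (H₀ f : ℝ × ℝ → ℂ) =ᵐ[μI2] fun xy => ((u δ xy.1 * u δ xy.2 : ℝ) : ℂ) * f xy)
    (f : L2sq) : 0 ≤ (inner ℂ f (H₀ f)).re := by
  rw [(H₀_re H₀ hH₀ f).2]
  refine integral_nonneg fun z => ?_
  exact mul_nonneg (mul_nonneg (u_nonneg hδ₁ hδ _) (u_nonneg hδ₁ hδ _)) (by positivity)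

lemma H₀_en_ne {δ : ℕ → ℝ} (H₀ : L2sq →L[ℂ] L2sq)
    (hH₀ : ∀ f : Lp ℂ 2 μI2,
      (H₀ f : ℝ × ℝ → ℂ) =ᵐ[μI2] fun xy => ((u δ xy.1 * u δ xy.2 : ℝ) : ℂ) * f xy)
    {m n : ℕ} (h : m ≠ n) : inner ℂ (en m) (H₀ (en n)) = 0 := by
  rw [(H₀_inner H₀ hH₀ _ _).2]
  refine integral_eq_zero_of_ae ?_
  filter_upwards [en_coe m, en_coe n] with z h1 h2
  rw [h1, h2, Complex.conj_ofReal, ← Complex.ofReal_mul, phi_mul_phi h]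
  simp

lemma H₀_en_le {δ : ℕ → ℝ} (hδ₁ : δ 1 = 1)
    (hδ : ∀ n : ℕ, 2 ≤ n → 0 ≤ δ n ∧ δ n ≤ (Real.sqrt 2 / 3) ^ n) (H₀ : L2sq →L[ℂ] L2sq)
    (hH₀ : ∀ f : Lp ℂ 2 μI2,
      (H₀ f : ℝ × ℝ → ℂ) =ᵐ[μI2] fun xy => ((u δ xy.1 * u δ xy.2 : ℝ) : ℂ) * f xy)
    (n : ℕ) : (inner ℂ (en n) (H₀ (en n))).re < (2 / 3 : ℝ) ^ (n + 1) := by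
  refine lt_of_le_of_lt ?_ (pow_lt_pow_left₀ sqrt_lt (by positivity) (Nat.succ_ne_zero n))
  obtain ⟨hi, he⟩ := H₀_re H₀ hH₀ (en n)
  have h1 := inner_en_en n n
  rw [if_pos rfl] at h1
  obtain ⟨hi2, he2⟩ := inner_eq_integral (en n) (f := en n) (F := en n) (ae_eq_refl _)
  have h2 : (fun z => conj (en n z) * en n z) = fun z => ((‖en n z‖ ^ 2 : ℝ) : ℂ) := by
    funext z
    rw [Complex.conj_mul']
    push_cast
    ring
  rw [h2] at hi2 he2
  rw [he2, integral_complex_ofReal] at h1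
  have h3 : ∫ z, ‖en n z‖ ^ 2 ∂μI2 = 1 := by exact_mod_cast h1
  have hi3 : Integrable (fun z => ‖en n z‖ ^ 2) μI2 := hi2.re
  have h4 : (Real.sqrt 2 / 3) ^ (n + 1) = ∫ z, (Real.sqrt 2 / 3) ^ (n + 1) * ‖en n z‖ ^ 2 ∂μI2 := by
    rw [integral_const_mul, h3, mul_one]
  rw [he, h4]
  refine integral_mono_ae hi (hi3.const_mul _) ?_
  filter_upwards [en_coe n, ae_fst ae_mem_In] with z hz hx
  obtain ⟨m, hm⟩ := hx
  by_cases hy : z.2 ∈ In n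
  · exact mul_le_mul_of_nonneg_right (uu_le hδ₁ hδ hm hy) (by positivity)
  · simp only [hz, phi_not_mem hy]; simp

end H0


theorem main_aux
    (δ : ℕ → ℝ) (hδ₁ : δ 1 = 1)
    (hδ : ∀ n : ℕ, 2 ≤ n → 0 ≤ δ n ∧ δ n ≤ (Real.sqrt 2 / 3) ^ n)
    (H₀ : Lp ℂ 2 μI2 →L[ℂ] Lp ℂ 2 μI2)
    (hH₀ : ∀ f : Lp ℂ 2 μI2,
      (H₀ f : ℝ × ℝ → ℂ) =ᵐ[μI2] fun xy => ((u δ xy.1 * u δ xy.2 : ℝ) : ℂ) * f xy)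
    (T₁ T₂ : Lp ℂ 2 μI2 →L[ℂ] Lp ℂ 2 μI2)
    (hT₁ : ∀ f : Lp ℂ 2 μI2,
      (T₁ f : ℝ × ℝ → ℂ) =ᵐ[μI2] fun xy => ∫ s, f (s, xy.2) ∂μI)
    (hT₂ : ∀ f : Lp ℂ 2 μI2,
      (T₂ f : ℝ × ℝ → ℂ) =ᵐ[μI2] fun xy => ∫ t, (k₂ xy.2 t : ℂ) * f (xy.1, t) ∂μI)
    (γ : ℝ) (hγ : 2 / 3 ≤ γ) :
    Emin (H₀ - ((γ : ℂ) • T₁ + T₂)) = -γ ∧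
    ¬ FiniteDimensional ℂ (eigBelow (H₀ - ((γ : ℂ) • T₁ + T₂)) (-γ)) ∧
    ∃ ω : ℕ → ℝ,
      (∀ n, ω n < -γ ∧
        Module.End.HasEigenvalue
          ((H₀ - ((γ : ℂ) • T₁ + T₂) : Lp ℂ 2 μI2 →L[ℂ] Lp ℂ 2 μI2) :
            Lp ℂ 2 μI2 →ₗ[ℂ] Lp ℂ 2 μI2) ((ω n : ℝ) : ℂ)) ∧
      Tendsto ω atTop (nhds (-γ)) := by
  choose S hS using exists_S T₂ hT₂
  have hs : ∀ n f g, inner ℂ (S n f) g = inner ℂ f (S n g) := fun n f g => S_symm (hS n) f g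
  have hc : ∀ m n f, S m (S n f) = if m = n then S n f else 0 :=
    fun m n f => S_comp (hS m) (hS n) f
  obtain ⟨T, hT⟩ := exists_TN_lim S hs hc
  obtain rfl := T₂_eq T₂ hT₂ hS hT
  have hHa : ∀ f, (H₀ - ((γ : ℂ) • T₁ + T)) f = H₀ f - ((γ : ℂ) • T₁ f + T f) := fun f => rfl
  refine abstract_efimov _ (T₁ ∘L T) ?_ (T₁T_compact T₁ hT₁ hS hT) ?_ ?_
  · intro f g
    rw [hHa, hHa, inner_sub_left, inner_sub_right, inner_add_left, inner_add_right,
      inner_smul_left, inner_smul_right, H₀_symm H₀ hH₀, T₁_symm T₁ hT₁, T_symm S hs hT,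
      Complex.conj_ofReal]
  · intro f
    have e1 := T_form_le S hs hc hT (f - T₁ f)
    have e2 : inner ℂ (f - T₁ f) (T (f - T₁ f)) = inner ℂ f (T f) - inner ℂ f (T₁ (T f)) := by
      rw [map_sub, T₁_comm T₁ hT₁ hS hT, inner_sub_left, inner_sub_right, inner_sub_right,
        T₁_symm T₁ hT₁, T₁_symm T₁ hT₁, T₁_idem T₁ hT₁]
      ring
    have e3 : inner ℂ (f - T₁ f) (f - T₁ f) = inner ℂ f f - inner ℂ f (T₁ f) := by
      rw [inner_sub_left, inner_sub_right, inner_sub_right, T₁_symm T₁ hT₁, T₁_symm T₁ hT₁,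
        T₁_idem T₁ hT₁]
      ring
    have e4 : ‖f - T₁ f‖ ^ 2 = ‖f‖ ^ 2 - (inner ℂ f (T₁ f)).re := by
      have := congrArg Complex.re e3
      rw [inner_self_eq_norm_sq_to_K, inner_self_eq_norm_sq_to_K, Complex.sub_re] at this
      exact_mod_cast this
    have e5 := H₀_nonneg hδ₁ hδ H₀ hH₀ f
    have e6 : (inner ℂ f ((H₀ - ((γ : ℂ) • T₁ + T)) f + (T₁ ∘L T) f)).re =
        (inner ℂ f (H₀ f)).re - γ * (inner ℂ f (T₁ f)).re -
          (inner ℂ (f - T₁ f) (T (f - T₁ f))).re := by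
      rw [e2, hHa, inner_add_right, inner_sub_right, inner_add_right, inner_smul_right,
        ContinuousLinearMap.comp_apply]
      simp only [Complex.add_re, Complex.sub_re, Complex.re_ofReal_mul]
      ring
    rw [e6]
    have e7 : 0 ≤ (γ - 2 / 3) * ‖f - T₁ f‖ ^ 2 := mul_nonneg (by linarith) (by positivity)
    have e8 : γ * ‖f - T₁ f‖ ^ 2 = γ * ‖f‖ ^ 2 - γ * (inner ℂ f (T₁ f)).re := by
      rw [e4]; ring
    linarith
  · have hHe : ∀ m n, inner ℂ (en m) ((H₀ - ((γ : ℂ) • T₁ + T)) (en n)) =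
        inner ℂ (en m) (H₀ (en n)) -
          ((γ + (2 / 3 : ℝ) ^ (n + 1) : ℝ) : ℂ) * (if m = n then 1 else 0) := by
      intro m n
      rw [hHa, T₁_en T₁ hT₁, T_en hS hT, inner_sub_right, inner_add_right, inner_smul_right,
        inner_smul_right, inner_en_en]
      push_cast
      ring
    refine neg_form en inner_en_en _ ?_ ?_
    · intro m n hmn
      rw [hHe, H₀_en_ne H₀ hH₀ hmn, if_neg hmn]
      simp
    · intro n
      rw [hHe, if_pos rfl, mul_one, Complex.sub_re, Complex.ofReal_re]
      linarith [H₀_en_le hδ₁ hδ H₀ hH₀ n]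

end Final

/-- **The example (Section 5).** For `γ ≥ 2/3` and `H = H₀ - (γT₁ + T₂)`, one has
`E_min(H) = -γ`, and `H` exhibits the Efimov effect below the bottom of its essential
spectrum: it has infinitely many eigenvalues (with multiplicity) strictly below `-γ`,
accumulating at `-γ`. -/
theorem efimov_effect_example
    (δ : ℕ → ℝ) (hδ₁ : δ 1 = 1)
    (hδ : ∀ n : ℕ, 2 ≤ n → 0 ≤ δ n ∧ δ n ≤ (Real.sqrt 2 / 3) ^ n)
    (H₀ : Lp ℂ 2 μI2 →L[ℂ] Lp ℂ 2 μI2)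
    (hH₀ : ∀ f : Lp ℂ 2 μI2,
      (H₀ f : ℝ × ℝ → ℂ) =ᵐ[μI2] fun xy => ((u δ xy.1 * u δ xy.2 : ℝ) : ℂ) * f xy)
    (T₁ T₂ : Lp ℂ 2 μI2 →L[ℂ] Lp ℂ 2 μI2)
    (hT₁ : ∀ f : Lp ℂ 2 μI2,
      (T₁ f : ℝ × ℝ → ℂ) =ᵐ[μI2] fun xy => ∫ s, f (s, xy.2) ∂μI)
    (hT₂ : ∀ f : Lp ℂ 2 μI2,
      (T₂ f : ℝ × ℝ → ℂ) =ᵐ[μI2] fun xy => ∫ t, (k₂ xy.2 t : ℂ) * f (xy.1, t) ∂μI)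
    (γ : ℝ) (hγ : 2 / 3 ≤ γ) :
    Emin (H₀ - ((γ : ℂ) • T₁ + T₂)) = -γ ∧
    ¬ FiniteDimensional ℂ (eigBelow (H₀ - ((γ : ℂ) • T₁ + T₂)) (-γ)) ∧
    ∃ ω : ℕ → ℝ,
      (∀ n, ω n < -γ ∧
        Module.End.HasEigenvalue
          ((H₀ - ((γ : ℂ) • T₁ + T₂) : Lp ℂ 2 μI2 →L[ℂ] Lp ℂ 2 μI2) :
            Lp ℂ 2 μI2 →ₗ[ℂ] Lp ℂ 2 μI2) ((ω n : ℝ) : ℂ)) ∧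
      Tendsto ω atTop (nhds (-γ)) := by
  exact main_aux δ hδ₁ hδ H₀ hH₀ T₁ T₂ hT₁ hT₂ γ hγ

end EfimovExample

end
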